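/- Four pairwise skew lines l₁,…,l₄ in ℙⁿ are in special position with respect to (n-2)-planes if and only if they lie on the same ruling of a smooth quadric surface Q ⊂ ℙ³ ⊂ ℙⁿ; in particular, in that case their linear span is a 3-dimensional linear subspace of ℙⁿ. -/

import Mathlib

open Module

section SpecialPosition

variable {K V : Type*} [Field K] [AddCommGroup V] [Module K V]

theorem inf_ne_bot_of_mem {A S : Submodule K V} {x : V} (hA : x ∈ A) (hS : x ∈ S) (hx : x ≠ 0) :
    A ⊓ S ≠ ⊥ :=
  (Submodule.ne_bot_iff _).2 ⟨x, ⟨hA, hS⟩, hx⟩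

/-- If `range (f + g)` meets every subspace meeting the three planes `range f`, `range g` and
`range (f + g ∘ₗ φ)`, then `φ` is a scalar. -/
theorem exists_eq_smul_one_of_forall_inf_ne_bot {f g : (Fin 2 → K) →ₗ[K] V}
    {φ : End K (Fin 2 → K)} (hf : Function.Injective f) (hg : Function.Injective g)
    (hfg : LinearMap.range f ⊓ LinearMap.range g = ⊥)
    (h : ∀ S : Submodule K V, LinearMap.range f ⊓ S ≠ ⊥ → LinearMap.range g ⊓ S ≠ ⊥ →
      LinearMap.range (f + g ∘ₗ φ) ⊓ S ≠ ⊥ → LinearMap.range (f + g) ⊓ S ≠ ⊥) :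
    ∃ c : K, φ = c • 1 := by
  have hsep : ∀ v w, f v = g w → v = 0 ∧ w = 0 := by
    intro v w hvw
    have : f v ∈ LinearMap.range f ⊓ LinearMap.range g := ⟨⟨v, rfl⟩, ⟨w, hvw.symm⟩⟩
    rw [hfg, Submodule.mem_bot] at this
    exact ⟨(map_eq_zero_iff f hf).1 this, (map_eq_zero_iff g hg).1 (hvw ▸ this)⟩
  refine φ.exists_eq_smul_id_of_forall_notLinearIndependent fun v hv => ?_
  rw [LinearIndependent.pair_iff] at hv
  have hv0 : v ≠ 0 := by rintro rfl; simpa using (hv 1 0 (by simp)).1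
  have hφ0 : φ v ≠ 0 := fun h0 => by simpa using (hv 0 1 (by simp [h0])).2
  have h1 : f v ∈ Submodule.span K {f v, g (φ v)} := Submodule.subset_span (by simp)
  have h2 : g (φ v) ∈ Submodule.span K {f v, g (φ v)} := Submodule.subset_span (by simp)
  have := h (Submodule.span K {f v, g (φ v)})
    (inf_ne_bot_of_mem ⟨v, rfl⟩ h1 ((map_ne_zero_iff f hf).2 hv0))
    (inf_ne_bot_of_mem ⟨φ v, rfl⟩ h2 ((map_ne_zero_iff g hg).2 hφ0))
    (inf_ne_bot_of_mem ⟨v, rfl⟩ (add_mem h1 h2) fun h0 => by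
      rw [LinearMap.add_apply, LinearMap.comp_apply, add_eq_zero_iff_eq_neg, ← map_neg] at h0
      exact hv0 (hsep _ _ h0).1)
  obtain ⟨x, ⟨⟨w, rfl⟩, hxs⟩, hx0⟩ := Submodule.exists_mem_ne_zero_of_ne_bot this
  obtain ⟨α, β, hαβ⟩ := Submodule.mem_span_pair.1 hxs
  have hw := hsep (α • v - w) (w - β • φ v) (by
    simp only [map_sub, map_smul]
    rw [LinearMap.add_apply] at hαβ
    rw [sub_eq_sub_iff_add_eq_add, hαβ, add_comm])
  have hα := hv α (-β) (by
    rw [neg_smul, ← sub_eq_add_neg, sub_eq_zero, sub_eq_zero.1 hw.1, sub_eq_zero.1 hw.2])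
  rw [← sub_eq_zero.1 hw.1, hα.1, zero_smul] at hx0
  exact hx0 (map_zero _)

/-- If the planes `range f`, `range g`, `range (f + g)` and `range (f + g ∘ₗ φ)` are isotropic for
a nondegenerate quadratic form on their span, then `φ` is a scalar. -/
theorem exists_eq_smul_one_of_quadraticForm {f g : (Fin 2 → K) →ₗ[K] V}
    {φ : End K (Fin 2 → K)} (hf : Function.Injective f)
    (hfg : LinearMap.range f ⊔ LinearMap.range g = ⊤) (Q : QuadraticForm K V)
    (hQ : ∀ x, (∀ y, QuadraticMap.polar Q x y = 0) → x = 0)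
    (hQf : ∀ v, Q (f v) = 0) (hQg : ∀ v, Q (g v) = 0) (hQfg : ∀ v, Q ((f + g) v) = 0)
    (hQφ : ∀ v, Q ((f + g ∘ₗ φ) v) = 0) :
    ∃ c : K, φ = c • 1 := by
  refine φ.exists_eq_smul_id_of_forall_notLinearIndependent fun v hv => ?_
  have hv0 : v ≠ 0 := by
    rintro rfl
    simpa using (LinearIndependent.pair_iff.1 hv 1 0 (by simp)).1
  refine hv0 ((map_eq_zero_iff f hf).1 (hQ _ fun y => ?_))
  obtain ⟨_, ⟨a, rfl⟩, _, ⟨b, rfl⟩, rfl⟩ :=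
    Submodule.mem_sup.1 (hfg ▸ Submodule.mem_top : y ∈ LinearMap.range f ⊔ LinearMap.range g)
  have hb : b ∈ Submodule.span K (Set.range ![v, φ v]) := by
    rw [hv.span_eq_top_of_card_eq_finrank (by simp)]
    trivial
  rw [Matrix.range_cons_cons_empty, Submodule.mem_span_pair] at hb
  obtain ⟨α, β, rfl⟩ := hb
  have h1 : QuadraticMap.polar Q (f v) (f a) = 0 := by
    rw [QuadraticMap.polar, ← map_add, hQf, hQf, hQf]; simp
  have h2 : QuadraticMap.polar Q (f v) (g v) = 0 := by
    have := hQfg v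
    rw [LinearMap.add_apply] at this
    rw [QuadraticMap.polar, this, hQf, hQg]; simp
  have h3 : QuadraticMap.polar Q (f v) (g (φ v)) = 0 := by
    have := hQφ v
    rw [LinearMap.add_apply, LinearMap.comp_apply] at this
    rw [QuadraticMap.polar, this, hQf, hQg]; simp
  simp [QuadraticMap.polar_add_right, QuadraticMap.polar_smul_right, h1, h2, h3]

theorem range_inf_ne_bot_iff_det_eq_zero {f : (Fin 2 → K) →ₗ[K] V} (hf : Function.Injective f)
    {L : Submodule K V} (π : V →ₗ[K] Fin 2 → K) (hπ : LinearMap.ker π = L) :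
    LinearMap.range f ⊓ L ≠ ⊥ ↔ (LinearMap.toMatrix' (π ∘ₗ f)).det = 0 := by
  rw [← Matrix.exists_mulVec_eq_zero_iff, Submodule.ne_bot_iff]
  simp only [LinearMap.toMatrix'_mulVec, LinearMap.comp_apply]
  constructor
  · rintro ⟨_, ⟨⟨v, rfl⟩, hv⟩, hv0⟩
    exact ⟨v, (map_ne_zero_iff f hf).1 hv0, by rwa [← hπ] at hv⟩
  · rintro ⟨v, hv0, hv⟩
    exact ⟨f v, ⟨⟨v, rfl⟩, hπ ▸ hv⟩, (map_ne_zero_iff f hf).2 hv0⟩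

/-- A nondegenerate quadratic form for which all the planes in the pencil spanned by two disjoint
planes are isotropic. -/
theorem exists_quadraticForm_of_range_inf_eq_bot {f g : (Fin 2 → K) →ₗ[K] V}
    (hf : Function.Injective f) (hg : Function.Injective g)
    (hfg : LinearMap.range f ⊓ LinearMap.range g = ⊥) (W : Submodule K V)
    (hW : LinearMap.range f ⊔ LinearMap.range g = W) :
    ∃ Q : QuadraticForm K W, (∀ x : W, (∀ y : W, QuadraticMap.polar Q x y = 0) → x = 0) ∧
      ∀ (s t : K) (v : Fin 2 → K) (h : s • f v + t • g v ∈ W), Q ⟨s • f v + t • g v, h⟩ = 0 := by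
  rw [← LinearMap.range_coprod] at hW
  subst hW
  have hinj : Function.Injective (f.coprod g) := by
    rw [← LinearMap.ker_eq_bot, LinearMap.ker_coprod_of_disjoint_range _ _ (disjoint_iff.2 hfg),
      LinearMap.ker_eq_bot.2 hf, LinearMap.ker_eq_bot.2 hg, Submodule.prod_bot]
  let e := LinearEquiv.ofInjective _ hinj
  let x : Fin 2 → ((Fin 2 → K) × (Fin 2 → K)) →ₗ[K] K :=
    fun i => LinearMap.proj i ∘ₗ LinearMap.fst K _ _
  let y : Fin 2 → ((Fin 2 → K) × (Fin 2 → K)) →ₗ[K] K :=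
    fun i => LinearMap.proj i ∘ₗ LinearMap.snd K _ _
  let q : QuadraticForm K ((Fin 2 → K) × (Fin 2 → K)) :=
    QuadraticMap.linMulLin (x 0) (y 1) - QuadraticMap.linMulLin (x 1) (y 0)
  have hq : ∀ a b, q (a, b) = a 0 * b 1 - a 1 * b 0 := fun a b => rfl
  refine ⟨q.comp e.symm.toLinearMap, ?_, ?_⟩
  · intro z hz
    obtain ⟨⟨a, b⟩, rfl⟩ := e.surjective z
    have hpol : ∀ a' b', q (a + a', b + b') - q (a, b) - q (a', b') = 0 := by
      intro a' b'
      simpa [QuadraticMap.polar] using hz (e (a', b'))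
    simp only [hq] at hpol
    have h1 := hpol 0 ![1, 0]
    have h2 := hpol 0 ![0, 1]
    have h3 := hpol ![1, 0] 0
    have h4 := hpol ![0, 1] 0
    simp at h1 h2 h3 h4
    have ha : a = 0 := by ext i; fin_cases i <;> simp <;> grind
    have hb : b = 0 := by ext i; fin_cases i <;> simp <;> grind
    rw [ha, hb]
    exact map_zero e
  · intro s t v h
    have : e.symm ⟨s • f v + t • g v, h⟩ = (s • v, t • v) := by
      rw [LinearEquiv.symm_apply_eq]
      apply Subtype.ext
      simp [e]
    rw [QuadraticMap.comp_apply, LinearEquiv.coe_coe, this, hq]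
    simp only [Pi.smul_apply, smul_eq_mul]
    ring

theorem injective_of_finrank_range_eq_two {f : (Fin 2 → K) →ₗ[K] V}
    (hf : finrank K (LinearMap.range f) = 2) : Function.Injective f := by
  rw [← LinearMap.ker_eq_bot, ← Submodule.finrank_eq_zero]
  have h := f.finrank_range_add_finrank_ker
  rw [finrank_fin_fun] at h
  omega

variable [FiniteDimensional K V]

/-- Four planes of a pencil spanned by two disjoint planes are in special position. -/
theorem inf_ne_bot_of_forall_ne_inf_ne_bot {f g : (Fin 2 → K) →ₗ[K] V} {c : K}
    {l : Fin 4 → Submodule K V} (hl : ∀ i, finrank K (l i) = 2) (h0 : LinearMap.range f = l 0)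
    (h1 : LinearMap.range g = l 1) (h2 : LinearMap.range (f + g) = l 2)
    (h3 : LinearMap.range (f + c • g) = l 3) (hc0 : c ≠ 0) (hc1 : c ≠ 1)
    {L : Submodule K V} (hL : finrank K L + 2 = finrank K V) (i : Fin 4)
    (hi : ∀ j, j ≠ i → l j ⊓ L ≠ ⊥) : l i ⊓ L ≠ ⊥ := by
  have hquot : finrank K (V ⧸ L) = finrank K (Fin 2 → K) := by
    have := L.finrank_quotient_add_finrank
    rw [finrank_fin_fun]
    omega
  let e := LinearEquiv.ofFinrankEq _ _ hquot
  let π : V →ₗ[K] Fin 2 → K := e.toLinearMap ∘ₗ L.mkQ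
  have hπ : LinearMap.ker π = L := by
    rw [LinearMap.ker_comp, LinearEquiv.ker]
    exact L.ker_mkQ
  have key : ∀ (p : (Fin 2 → K) →ₗ[K] V) (j : Fin 4), LinearMap.range p = l j →
      (l j ⊓ L ≠ ⊥ ↔ (LinearMap.toMatrix' (π ∘ₗ p)).det = 0) := by
    intro p j hp
    rw [← hp]
    exact range_inf_ne_bot_iff_det_eq_zero
      (injective_of_finrank_range_eq_two (by rw [hp]; exact hl j)) π hπ
  have k0 := key _ 0 h0
  have k1 := key _ 1 h1
  have k2 := key _ 2 h2
  have k3 := key _ 3 h3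
  simp only [LinearMap.comp_add, LinearMap.comp_smul, map_add, map_smul, Matrix.det_fin_two,
    Matrix.add_apply, Matrix.smul_apply, smul_eq_mul] at k0 k1 k2 k3
  have hc1' : c - 1 ≠ 0 := sub_ne_zero.2 hc1
  generalize LinearMap.toMatrix' (π ∘ₗ f) = P at *
  generalize LinearMap.toMatrix' (π ∘ₗ g) = R at *
  fin_cases i
  · have e1 := k1.1 (hi 1 (by decide))
    have e2 := k2.1 (hi 2 (by decide))
    have e3 := k3.1 (hi 3 (by decide))
    refine k0.2 (mul_left_cancel₀ hc1' ?_)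
    linear_combination c * e2 - e3 + (c ^ 2 - c) * e1
  · have e0 := k0.1 (hi 0 (by decide))
    have e2 := k2.1 (hi 2 (by decide))
    have e3 := k3.1 (hi 3 (by decide))
    refine k1.2 (mul_left_cancel₀ (mul_ne_zero hc0 hc1') ?_)
    linear_combination e3 - c * e2 + (c - 1) * e0
  · have e0 := k0.1 (hi 0 (by decide))
    have e1 := k1.1 (hi 1 (by decide))
    have e3 := k3.1 (hi 3 (by decide))
    refine k2.2 (mul_left_cancel₀ hc0 ?_)
    linear_combination e3 + (c - 1) * e0 - (c ^ 2 - c) * e1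
  · have e0 := k0.1 (hi 0 (by decide))
    have e1 := k1.1 (hi 1 (by decide))
    have e2 := k2.1 (hi 2 (by decide))
    refine k3.2 ?_
    linear_combination c * e2 - (c - 1) * e0 + (c ^ 2 - c) * e1

/-- A common complement of `A` and `B` in `A ⊔ B` is the graph of an isomorphism `A ≃ B`. -/
theorem exists_linearEquiv_mem_iff_of_le_sup {A B C : Submodule K V}
    (hA : finrank K A = finrank K C) (hB : finrank K B = finrank K C)
    (hAB : A ⊓ B = ⊥) (hAC : A ⊓ C = ⊥) (hBC : B ⊓ C = ⊥) (hC : C ≤ A ⊔ B) :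
    ∃ θ : A ≃ₗ[K] B, ∀ x, x ∈ C ↔ ∃ a : A, (a : V) + θ a = x := by
  obtain ⟨L, hBL, hL⟩ := (disjoint_iff.2 hAB).symm.exists_isCompl
  replace hL := hL.symm
  have key : ∀ x ∈ C, x - A.projectionOnto L hL x ∈ B := by
    intro x hx
    obtain ⟨a, ha, b, hb, rfl⟩ := Submodule.mem_sup.1 (hC hx)
    have h1 : A.projectionOnto L hL a = ⟨a, ha⟩ := Submodule.projectionOnto_apply_of_mem_left hL ha
    have h2 : A.projectionOnto L hL b = 0 :=
      (Submodule.projectionOnto_apply_eq_zero_iff hL).2 (hBL hb)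
    simpa [h1, h2] using hb
  let p : C →ₗ[K] A := (A.projectionOnto L hL).comp C.subtype
  let q : C →ₗ[K] B := (C.subtype - A.subtype.comp p).codRestrict B fun x => key x x.2
  have hpq : ∀ x : C, (p x : V) + q x = x := fun x => add_sub_cancel (p x : V) (x : V)
  have hp : Function.Injective p := by
    rw [← LinearMap.ker_eq_bot, LinearMap.ker_eq_bot']
    intro x hx
    have h := hpq x
    rw [hx, ZeroMemClass.coe_zero, zero_add] at h
    have : (x : V) ∈ B ⊓ C := ⟨h ▸ (q x).2, x.2⟩
    rw [hBC] at this
    exact Subtype.ext this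
  have hq : Function.Injective q := by
    rw [← LinearMap.ker_eq_bot, LinearMap.ker_eq_bot']
    intro x hx
    have h := hpq x
    rw [hx, ZeroMemClass.coe_zero, add_zero] at h
    have : (x : V) ∈ A ⊓ C := ⟨h ▸ (p x).2, x.2⟩
    rw [hAC] at this
    exact Subtype.ext this
  let P := LinearMap.linearEquivOfInjective p hp hA.symm
  let Q := LinearMap.linearEquivOfInjective q hq hB.symm
  have hPQ : ∀ x : C, (P x : V) + Q x = x := hpq
  refine ⟨P.symm.trans Q, fun x => ⟨fun hx => ⟨P ⟨x, hx⟩, ?_⟩, ?_⟩⟩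
  · simpa using hPQ ⟨x, hx⟩
  · rintro ⟨a, rfl⟩
    have h := hPQ (P.symm a)
    rw [LinearEquiv.apply_symm_apply] at h
    rw [LinearEquiv.trans_apply, h]
    exact (P.symm a).2

/-- Four pairwise disjoint planes in a four-dimensional space, in coordinates adapted to the
first three of them. -/
theorem exists_coordinates_of_le_sup {A B C D : Submodule K V}
    (hA : finrank K A = 2) (hB : finrank K B = 2) (hC : finrank K C = 2) (hD : finrank K D = 2)
    (hAB : A ⊓ B = ⊥) (hAC : A ⊓ C = ⊥) (hBC : B ⊓ C = ⊥) (hAD : A ⊓ D = ⊥) (hBD : B ⊓ D = ⊥)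
    (hCAB : C ≤ A ⊔ B) (hDAB : D ≤ A ⊔ B) :
    ∃ (f g : (Fin 2 → K) →ₗ[K] V) (φ : End K (Fin 2 → K)),
      Function.Injective f ∧ Function.Injective g ∧ LinearMap.range f = A ∧
        LinearMap.range g = B ∧ LinearMap.range (f + g) = C ∧
        LinearMap.range (f + g ∘ₗ φ) = D := by
  obtain ⟨θ, hθ⟩ := exists_linearEquiv_mem_iff_of_le_sup (hA.trans hC.symm) (hB.trans hC.symm)
    hAB hAC hBC hCAB
  obtain ⟨η, hη⟩ := exists_linearEquiv_mem_iff_of_le_sup (hA.trans hD.symm) (hB.trans hD.symm)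
    hAB hAD hBD hDAB
  let e : (Fin 2 → K) ≃ₗ[K] A := LinearEquiv.ofFinrankEq _ _ (by simp [hA])
  refine ⟨A.subtype ∘ₗ e, B.subtype ∘ₗ (e.trans θ).toLinearMap,
    (e.trans (η.trans (θ.symm.trans e.symm))),
    A.injective_subtype.comp e.injective,
    B.injective_subtype.comp (e.trans θ).injective, ?_, ?_, ?_, ?_⟩
  · rw [LinearMap.range_comp, LinearEquiv.range, Submodule.map_top, Submodule.range_subtype]
  · rw [LinearMap.range_comp, LinearEquiv.range, Submodule.map_top,
      Submodule.range_subtype]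
  · ext x
    rw [hθ, e.surjective.exists]
    simp
  · ext x
    rw [hη, e.surjective.exists]
    simp

/-- If the plane `D` meets the span of any three nonzero vectors taken one from each of `A`, `B`
and `C`, then `A` is contained in `B ⊔ D`. -/
theorem le_sup_of_forall_span_inf_ne_bot {A B C D : Submodule K V}
    (hB : finrank K B = 2) (hC : finrank K C = 2) (hD : finrank K D = 2)
    (hBD : B ⊓ D = ⊥) (hCD : C ⊓ D = ⊥)
    (h : ∀ a ∈ A, ∀ b ∈ B, ∀ c ∈ C, a ≠ 0 → b ≠ 0 → c ≠ 0 →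
      D ⊓ Submodule.span K {a, b, c} ≠ ⊥) :
    A ≤ B ⊔ D := by
  intro a ha
  by_contra haBD
  have ha0 : a ≠ 0 := fun h0 => haBD (h0 ▸ zero_mem _)
  have coeff : ∀ b ∈ B, b ≠ 0 → ∀ c ∈ C, c ≠ 0 → ∃ α β : K, c - α • a - β • b ∈ D := by
    intro b hb hb0 c hc hc0
    obtain ⟨x, hx, hx0⟩ := Submodule.exists_mem_ne_zero_of_ne_bot (h a ha b hb c hc ha0 hb0 hc0)
    obtain ⟨hxD, hxs⟩ := Submodule.mem_inf.1 hx
    obtain ⟨α, β, γ, rfl⟩ := Submodule.mem_span_triple.1 hxs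
    have hγ : γ ≠ 0 := by
      rintro rfl
      rw [zero_smul, add_zero] at hxD hx0
      have hα : α = 0 := by
        by_contra hα
        refine haBD ?_
        have : a = (-α⁻¹ * β) • b + α⁻¹ • (α • a + β • b) := by
          rw [smul_add, smul_smul, smul_smul, inv_mul_cancel₀ hα]
          module
        rw [this]
        exact Submodule.add_mem_sup (B.smul_mem _ hb) (D.smul_mem _ hxD)
      rw [hα, zero_smul, zero_add] at hxD hx0
      have : β • b ∈ B ⊓ D := ⟨B.smul_mem _ hb, hxD⟩
      rw [hBD] at this
      exact hx0 this
    refine ⟨-(γ⁻¹ * α), -(γ⁻¹ * β), ?_⟩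
    have : c - (-(γ⁻¹ * α)) • a - (-(γ⁻¹ * β)) • b = γ⁻¹ • (α • a + β • b + γ • c) := by
      rw [smul_add, smul_smul, inv_mul_cancel₀ hγ]
      module
    rw [this]
    exact D.smul_mem _ hxD
  have hCle : C ≤ K ∙ a ⊔ D := by
    intro c hc
    by_cases hc0 : c = 0
    · rw [hc0]; exact zero_mem _
    let e := finBasisOfFinrankEq K B hB
    have hne : ∀ i, (e i : V) ≠ 0 := fun i h0 => e.ne_zero i (Subtype.ext h0)
    obtain ⟨α, β, h1⟩ := coeff _ (e 0).2 (hne 0) c hc hc0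
    obtain ⟨α', β', h2⟩ := coeff _ (e 1).2 (hne 1) c hc hc0
    have hdiff : (α' - α) • a + (β' • (e 1 : V) - β • (e 0 : V)) ∈ D := by
      convert D.sub_mem h1 h2 using 1
      module
    have hαα : α' - α = 0 := by
      by_contra hα
      refine haBD ?_
      have : a = (α' - α)⁻¹ • (β • (e 0 : V) - β' • (e 1 : V)) +
          (α' - α)⁻¹ • ((α' - α) • a + (β' • (e 1 : V) - β • (e 0 : V))) := by
        rw [smul_add _ ((α' - α) • a), smul_smul, inv_mul_cancel₀ hα]
        module
      rw [this]
      exact Submodule.add_mem_sup (B.smul_mem _ (B.sub_mem (B.smul_mem _ (e 0).2)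
        (B.smul_mem _ (e 1).2))) (D.smul_mem _ hdiff)
    rw [hαα, zero_smul, zero_add] at hdiff
    have hbot : β' • (e 1 : V) - β • (e 0 : V) ∈ B ⊓ D :=
      ⟨B.sub_mem (B.smul_mem _ (e 1).2) (B.smul_mem _ (e 0).2), hdiff⟩
    rw [hBD, Submodule.mem_bot] at hbot
    have hli := e.linearIndependent
    rw [Fintype.linearIndependent_iff] at hli
    have hβ : β = 0 := by
      have := hli ![-β, β'] (by
        apply Subtype.ext
        rw [Fin.sum_univ_two]
        simp only [Matrix.cons_val_zero, Matrix.cons_val_one, Submodule.coe_add,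
          Submodule.coe_smul, ZeroMemClass.coe_zero]
        rw [← hbot]; module) 0
      simpa using this
    rw [hβ, zero_smul, sub_zero] at h1
    have : c = α • a + (c - α • a) := by abel
    rw [this]
    exact Submodule.add_mem_sup (Submodule.smul_mem _ _ (Submodule.mem_span_singleton_self a)) h1
  have hle := Submodule.finrank_mono (sup_le hCle (le_sup_right (a := K ∙ a) (b := D)))
  have h1 := Submodule.finrank_sup_add_finrank_inf_eq C D
  have h2 := Submodule.finrank_add_le_finrank_add_finrank (K ∙ a) D
  have h3 := finrank_span_singleton (K := K) ha0
  rw [hCD, finrank_bot] at h1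
  omega

/-- If `A` meets every subspace of codimension `dim A` with a given upward closed property, then
it meets every subspace with that property. -/
theorem inf_ne_bot_of_forall_finrank_add_eq {A : Submodule K V} {P : Submodule K V → Prop}
    (hP : ∀ S T, S ≤ T → P S → P T)
    (h : ∀ L : Submodule K V, finrank K A + finrank K L = finrank K V → P L → A ⊓ L ≠ ⊥)
    (S : Submodule K V) (hS : P S) : A ⊓ S ≠ ⊥ := by
  intro hAS
  obtain ⟨L, hSL, hL⟩ := (disjoint_iff.2 hAS).symm.exists_isCompl
  exact h L (Submodule.finrank_add_eq_of_isCompl hL.symm) (hP S L hSL hS)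
    (disjoint_iff.1 hL.symm.disjoint)

/-- Four pairwise disjoint planes in special position are all contained in the span of the first
two. -/
theorem le_sup_of_forall_inf_ne_bot {l : Fin 4 → Submodule K V} (hl : ∀ i, finrank K (l i) = 2)
    (hskew : ∀ i j, i ≠ j → l i ⊓ l j = ⊥)
    (hs : ∀ i, ∀ S : Submodule K V, (∀ j, j ≠ i → l j ⊓ S ≠ ⊥) → l i ⊓ S ≠ ⊥) (i : Fin 4) :
    l i ≤ l 0 ⊔ l 1 := by
  have key : ∀ j k, j ≠ 1 → k ≠ 1 → (∀ m, m ≠ 1 → m = j ∨ m = 0 ∨ m = k) →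
      l j ≤ l 0 ⊔ l 1 := by
    intro j k hj hk hjk
    refine le_sup_of_forall_span_inf_ne_bot (hl 0) (hl k) (hl 1) (hskew 0 1 (by decide))
      (hskew k 1 hk) fun a ha b hb c hc ha0 hb0 hc0 => hs 1 _ fun m hm => ?_
    rcases hjk m hm with rfl | rfl | rfl
    · exact inf_ne_bot_of_mem ha (Submodule.subset_span (by simp)) ha0
    · exact inf_ne_bot_of_mem hb (Submodule.subset_span (by simp)) hb0
    · exact inf_ne_bot_of_mem hc (Submodule.subset_span (by simp)) hc0
  fin_cases i
  · exact le_sup_left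
  · exact le_sup_right
  · exact key 2 3 (by decide) (by decide) (by decide)
  · exact key 3 2 (by decide) (by decide) (by decide)

end SpecialPosition

/-- Four pairwise skew lines `l₁,…,l₄` in `ℙⁿ` are in special position with respect to
`(n-2)`-planes if and only if they lie on a smooth quadric surface `Q ⊂ ℙ³ ⊂ ℙⁿ`
(since the lines are pairwise skew, they then automatically lie on the same ruling of
`Q`); in particular, in that case their linear span is a `3`-dimensional linear subspace
of `ℙⁿ` (a `4`-dimensional linear subspace of `ℂ^{n+1}`). The quadric is encoded as a
quadratic form with nondegenerate polar form on a `4`-dimensional linear subspace `W`,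
vanishing on each line. -/
theorem four_skew_lines_special_position_iff_quadric
    (n : ℕ) (hn : 3 ≤ n)
    (l : Fin 4 → Submodule ℂ (Fin (n + 1) → ℂ))
    (hl : ∀ i, finrank ℂ (l i) = 2)
    (hskew : ∀ i j, i ≠ j → l i ⊓ l j = ⊥) :
    ((∀ i, ∀ L : Submodule ℂ (Fin (n + 1) → ℂ), finrank ℂ L = n - 1 →
        (∀ j, j ≠ i → l j ⊓ L ≠ ⊥) → l i ⊓ L ≠ ⊥)
      ↔ ∃ (W : Submodule ℂ (Fin (n + 1) → ℂ)) (hW : ∀ i, l i ≤ W),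
          finrank ℂ W = 4 ∧
          ∃ Q : QuadraticForm ℂ W,
            (∀ x : W, (∀ y : W, QuadraticMap.polar Q x y = 0) → x = 0) ∧
            ∀ i, ∀ x : Fin (n + 1) → ℂ, ∀ hx : x ∈ l i, Q ⟨x, hW i hx⟩ = 0) ∧
    ((∀ i, ∀ L : Submodule ℂ (Fin (n + 1) → ℂ), finrank ℂ L = n - 1 →
        (∀ j, j ≠ i → l j ⊓ L ≠ ⊥) → l i ⊓ L ≠ ⊥)
      → finrank ℂ ↥(⨆ i, l i) = 4) := by
  have hVdim : finrank ℂ (Fin (n + 1) → ℂ) = n + 1 := finrank_fin_fun ℂ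
  have h01 : finrank ℂ ↥(l 0 ⊔ l 1) = 4 := by
    have h := Submodule.finrank_sup_add_finrank_inf_eq (l 0) (l 1)
    rw [hskew 0 1 (by decide), finrank_bot, hl, hl] at h
    omega
  have extend : (∀ i, ∀ L : Submodule ℂ (Fin (n + 1) → ℂ), finrank ℂ L = n - 1 →
      (∀ j, j ≠ i → l j ⊓ L ≠ ⊥) → l i ⊓ L ≠ ⊥) →
      ∀ i, ∀ S : Submodule ℂ (Fin (n + 1) → ℂ), (∀ j, j ≠ i → l j ⊓ S ≠ ⊥) → l i ⊓ S ≠ ⊥ := by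
    intro h i
    refine inf_ne_bot_of_forall_finrank_add_eq
      (fun S T hST hS j hj hbot => hS j hj (le_bot_iff.1 (hbot ▸ inf_le_inf_left _ hST)))
      fun L hL => h i L ?_
    rw [hl, hVdim] at hL
    omega
  refine ⟨⟨fun h => ?_, ?_⟩, fun h => ?_⟩
  · replace h := extend h
    have hle := le_sup_of_forall_inf_ne_bot hl hskew h
    obtain ⟨f, g, φ, hf, hg, h0, h1, h2, h3⟩ := exists_coordinates_of_le_sup (hl 0) (hl 1) (hl 2)
      (hl 3) (hskew 0 1 (by decide)) (hskew 0 2 (by decide)) (hskew 1 2 (by decide))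
      (hskew 0 3 (by decide)) (hskew 1 3 (by decide)) (hle 2) (hle 3)
    have hfg : LinearMap.range f ⊓ LinearMap.range g = ⊥ := by
      rw [h0, h1]; exact hskew 0 1 (by decide)
    obtain ⟨c, rfl⟩ := exists_eq_smul_one_of_forall_inf_ne_bot (φ := φ) hf hg hfg (by
      rw [h0, h1, h2, h3]
      refine fun S hS0 hS1 hS3 => h 2 S fun j hj => ?_
      fin_cases j
      exacts [hS0, hS1, absurd rfl hj, hS3])
    obtain ⟨Q, hQ, hQ0⟩ := exists_quadraticForm_of_range_inf_eq_bot hf hg hfg (l 0 ⊔ l 1)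
      (by rw [h0, h1])
    refine ⟨l 0 ⊔ l 1, hle, h01, Q, hQ, ?_⟩
    have hzero : ∀ (s t : ℂ) (v : Fin 2 → ℂ) (x : Fin (n + 1) → ℂ) (hx : x ∈ l 0 ⊔ l 1),
        s • f v + t • g v = x → Q ⟨x, hx⟩ = 0 := by
      rintro s t v _ hx rfl
      exact hQ0 s t v hx
    intro i x hx
    fin_cases i
    · obtain ⟨v, rfl⟩ := h0.symm ▸ hx
      exact hzero 1 0 v _ _ (by simp)
    · obtain ⟨v, rfl⟩ := h1.symm ▸ hx
      exact hzero 0 1 v _ _ (by simp)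
    · obtain ⟨v, rfl⟩ := h2.symm ▸ hx
      exact hzero 1 1 v _ _ (by simp)
    · obtain ⟨v, rfl⟩ := h3.symm ▸ hx
      exact hzero 1 c v _ _ (by simp)
  · rintro ⟨W, hW, hWdim, Q, hQ, hQ0⟩ i L hL hi
    have hsup : l 0 ⊔ l 1 = W :=
      Submodule.eq_of_le_of_finrank_eq (sup_le (hW 0) (hW 1)) (h01.trans hWdim.symm)
    obtain ⟨f, g, φ, hf, hg, h0, h1, h2, h3⟩ := exists_coordinates_of_le_sup (hl 0) (hl 1) (hl 2)
      (hl 3) (hskew 0 1 (by decide)) (hskew 0 2 (by decide)) (hskew 1 2 (by decide))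
      (hskew 0 3 (by decide)) (hskew 1 3 (by decide)) (hsup ▸ hW 2) (hsup ▸ hW 3)
    have hfl : ∀ v, f v ∈ l 0 := fun v => h0 ▸ ⟨v, rfl⟩
    have hgl : ∀ v, g v ∈ l 1 := fun v => h1 ▸ ⟨v, rfl⟩
    obtain ⟨c, rfl⟩ := exists_eq_smul_one_of_quadraticForm (φ := φ)
      (f := f.codRestrict W fun v => hW 0 (hfl v)) (g := g.codRestrict W fun v => hW 1 (hgl v))
      (fun v w hvw => hf (congrArg Subtype.val hvw)) (by
        rw [eq_top_iff]
        rintro ⟨x, hx⟩ -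
        rw [← hsup] at hx
        rw [← h0, ← h1] at hx
        obtain ⟨_, ⟨v, rfl⟩, _, ⟨w, rfl⟩, rfl⟩ := Submodule.mem_sup.1 hx
        exact Submodule.mem_sup.2 ⟨_, ⟨v, rfl⟩, _, ⟨w, rfl⟩, rfl⟩) Q hQ
      (fun v => hQ0 0 _ (hfl v)) (fun v => hQ0 1 _ (hgl v))
      (fun v => hQ0 2 ((f + g) v) (h2 ▸ ⟨v, rfl⟩))
      (fun v => hQ0 3 ((f + g ∘ₗ φ) v) (h3 ▸ ⟨v, rfl⟩))
    have hne : ∀ i j, i ≠ j → l i ≠ l j := by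
      intro i j hij heq
      have h := hskew i j hij
      have h' := hl j
      rw [heq, inf_idem] at h
      rw [h, finrank_bot] at h'
      omega
    have h3' : LinearMap.range (f + c • g) = l 3 := by
      rw [← h3, LinearMap.comp_smul, Module.End.one_eq_id, LinearMap.comp_id]
    refine inf_ne_bot_of_forall_ne_inf_ne_bot hl h0 h1 h2 h3' ?_ ?_ (by omega) i hi
    · rintro rfl
      exact hne 0 3 (by decide) (by rw [← h0, ← h3', zero_smul, add_zero])
    · rintro rfl
      exact hne 2 3 (by decide) (by rw [← h2, ← h3', one_smul])
  · have hle := le_sup_of_forall_inf_ne_bot hl hskew (extend h)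
    rwa [le_antisymm (iSup_le hle) (sup_le (le_iSup l 0) (le_iSup l 1))]
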